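/- arXiv:2310.03475 — 3 statements merged into one kernel-verified Lean document; each statement's English description precedes it below -/
import Mathlib

section
/- Let M be a finite set of indivisible items and let v1, v2, u1, u2 : 2^M → ℝ be monotone valuations with value 0 on the empty set. Then there exists a partition (A1, A2) of M that is doubly EF-1: there exist sets B1, B3 ⊆ A2 and B2, B4 ⊆ A1, each of cardinality at most 1, such that v1(A1) ≥ v1(A2 \ B1), v2(A2) ≥ v2(A1 \ B2), u1(A1) ≥ u1(A2 \ B3), and u2(A2) ≥ u2(A1 \ B4). -/
/-- The antipode of a signed element: same index, opposite sign. -/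
def antipode {ι : Type*} (a : ι × Bool) : ι × Bool := (a.1, !a.2)

theorem antipode_antipode {ι : Type*} (a : ι × Bool) : antipode (antipode a) = a := by
  simp [antipode]

theorem antipode_injective {ι : Type*} : Function.Injective (antipode (ι := ι)) :=
  Function.LeftInverse.injective antipode_antipode

theorem eq_or_eq_antipode {ι : Type*} {a b : ι × Bool} (h : a.1 = b.1) :
    a = b ∨ a = antipode b := by
  obtain ⟨i, s⟩ := a
  obtain ⟨j, t⟩ := b
  cases s <;> cases t <;> simp_all [antipode]

section Cochains

variable {V L : Type*} [DecidableEq V] [DecidableEq L]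

/-- The mod 2 cochain `σ ↦ φ (v * σ)`, where `v * σ` is the join with the vertex `v`. -/
def coneCochain (v : L) (φ : Finset L → ZMod 2) (σ : Finset L) : ZMod 2 :=
  if v ∈ σ then 0 else φ (insert v σ)

/-- The mod 2 simplicial coboundary. -/
def coboundary (φ : Finset L → ZMod 2) (σ : Finset L) : ZMod 2 :=
  ∑ w ∈ σ, φ (σ.erase w)

/-- The value of the cochain `φ` on the image under `lam` of the sum of all maximal chains of
nonempty subsets of `x`, where `k` is the cardinality of `x`. -/
def chainSum (lam : Finset V → L) : ℕ → Finset V → (Finset L → ZMod 2) → ZMod 2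
  | 0, _, φ => φ ∅
  | k + 1, x, φ => ∑ l ∈ x, chainSum lam k (x.erase l) (coneCochain (lam x) φ)

theorem coneCochain_coboundary (v : L) (φ : Finset L → ZMod 2) :
    coneCochain v (coboundary φ) = φ + coboundary (coneCochain v φ) := by
  funext σ
  simp only [Pi.add_apply, coneCochain, coboundary]
  split_ifs with h
  · rw [Finset.sum_eq_single_of_mem v h]
    · simp [Finset.insert_erase h, CharTwo.add_self_eq_zero]
    · intro b _ hb
      simp [h, hb.symm]
  · rw [Finset.sum_insert h, Finset.erase_insert h]
    congr 1
    refine Finset.sum_congr rfl fun w hw => ?_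
    have hvw : v ≠ w := fun e => h (e ▸ hw)
    rw [if_neg (fun hm => h (Finset.mem_of_mem_erase hm)), Finset.erase_insert_of_ne hvw]

theorem coneCochain_add (v : L) (φ ψ : Finset L → ZMod 2) :
    coneCochain v (φ + ψ) = coneCochain v φ + coneCochain v ψ := by
  funext σ
  simp only [Pi.add_apply, coneCochain]
  split_ifs <;> simp

theorem chainSum_add (lam : Finset V → L) (k : ℕ) (x : Finset V) (φ ψ : Finset L → ZMod 2) :
    chainSum lam k x (φ + ψ) = chainSum lam k x φ + chainSum lam k x ψ := by
  induction k generalizing x φ ψ with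
  | zero => simp [chainSum]
  | succ k ih => simp only [chainSum, coneCochain_add, ih, Finset.sum_add_distrib]

theorem sum_sum_erase_erase (x : Finset V) (f : Finset V → ZMod 2) :
    ∑ l ∈ x, ∑ l' ∈ x.erase l, f ((x.erase l).erase l') = 0 := by
  rw [Finset.sum_sigma']
  refine Finset.sum_involution (fun p _ => ⟨p.2, p.1⟩) ?_ ?_ ?_ ?_
  · rintro ⟨a, b⟩ _
    simp only [Finset.erase_right_comm (a := b) (b := a)]
    exact CharTwo.add_self_eq_zero _
  · rintro ⟨a, b⟩ h _ he
    simp at h he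
    exact h.2.1 he.1
  · rintro ⟨a, b⟩ h
    simp at h ⊢
    exact ⟨h.2.2, Ne.symm h.2.1, h.1⟩
  · rintro ⟨a, b⟩ h
    rfl

theorem chainSum_coboundary (lam : Finset V → L) (k : ℕ) (x : Finset V) (hx : x.card = k + 1)
    (φ : Finset L → ZMod 2) :
    chainSum lam (k + 1) x (coboundary φ) = ∑ l ∈ x, chainSum lam k (x.erase l) φ := by
  induction k generalizing x φ with
  | zero => simp [chainSum, coneCochain, coboundary]
  | succ k ih =>
    rw [chainSum]
    simp only [coneCochain_coboundary, chainSum_add, Finset.sum_add_distrib]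
    rw [add_eq_left, ← sum_sum_erase_erase x
      (fun z => chainSum lam k z (coneCochain (lam x) φ))]
    refine Finset.sum_congr rfl fun l hl => ih _ ?_ _
    rw [Finset.card_erase_of_mem hl, hx]
    rfl

end Cochains

section Labels

variable {β : Type*}

/-- A set of signed elements is consistent on `E` if it is supported on `E` and never contains
an element with both signs. -/
def IsSignVector (E : Finset β) (x : Finset (β × Bool)) : Prop :=
  ∀ a ∈ x, a.1 ∈ E ∧ antipode a ∉ x

theorem IsSignVector.mono {E : Finset β} {x y : Finset (β × Bool)} (hy : IsSignVector E y)
    (h : x ⊆ y) : IsSignVector E x :=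
  fun a ha => ⟨(hy a (h ha)).1, fun h' => (hy a (h ha)).2 (h h')⟩

variable [DecidableEq β]

theorem chainSum_congr (lam : Finset (β × Bool) → ℕ × Bool) (k : ℕ) (x : Finset (β × Bool))
    (hx : x.card = k)
    (hlam : ∀ y z, y ⊆ z → z ⊆ x → y.Nonempty → lam y ≠ antipode (lam z))
    (φ ψ : Finset (ℕ × Bool) → ZMod 2)
    (h : ∀ σ : Finset (ℕ × Bool), σ.card = k → (∀ a ∈ σ, ∃ y ⊆ x, y.Nonempty ∧ lam y = a) →
      Set.InjOn Prod.fst (σ : Set (ℕ × Bool)) → φ σ = ψ σ) :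
    chainSum lam k x φ = chainSum lam k x ψ := by
  induction k generalizing x φ ψ with
  | zero => exact h ∅ (by simp) (by simp) (by simp)
  | succ k ih =>
    refine Finset.sum_congr rfl fun l hl => ?_
    have hsub := Finset.erase_subset l x
    refine ih _ (by rw [Finset.card_erase_of_mem hl, hx]; rfl)
      (fun y z hyz hz => hlam y z hyz (hz.trans hsub)) _ _ fun τ hτ hτl hτi => ?_
    unfold coneCochain
    split_ifs with hv
    · rfl
    · refine h _ (by rw [Finset.card_insert_of_notMem hv, hτ]) ?_ ?_
      · intro a ha
        rcases Finset.mem_insert.1 ha with rfl | ha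
        · exact ⟨x, subset_rfl, ⟨l, hl⟩, rfl⟩
        · obtain ⟨y, hy, hy'⟩ := hτl a ha
          exact ⟨y, hy.trans hsub, hy'⟩
      · rw [Finset.coe_insert, Set.injOn_insert (by simpa using hv)]
        refine ⟨hτi, ?_⟩
        rintro ⟨a, ha, hav⟩
        obtain ⟨y, hy, hyn, rfl⟩ := hτl a ha
        rcases eq_or_eq_antipode hav with e | e
        · exact hv (e ▸ ha)
        · exact hlam y x (hy.trans hsub) subset_rfl hyn e

theorem chainSum_image_antipode (lam : Finset (β × Bool) → ℕ × Bool) (k : ℕ)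
    (x : Finset (β × Bool)) (hx : x.card = k)
    (hlam : ∀ y ⊆ x, y.Nonempty → lam (y.image antipode) = antipode (lam y))
    (φ : Finset (ℕ × Bool) → ZMod 2) :
    chainSum lam k (x.image antipode) φ = chainSum lam k x (fun σ => φ (σ.image antipode)) := by
  induction k generalizing x φ with
  | zero => simp [chainSum]
  | succ k ih =>
    have hxn : x.Nonempty := Finset.card_pos.1 (by omega)
    simp only [chainSum]
    rw [Finset.sum_image antipode_injective.injOn]
    refine Finset.sum_congr rfl fun l hl => ?_
    rw [← Finset.image_erase antipode_injective, ih _ (by rw [Finset.card_erase_of_mem hl, hx]; rfl)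
      (fun y hy => hlam y (hy.trans (Finset.erase_subset l x)))]
    congr 1
    funext σ
    simp only [coneCochain, hlam x subset_rfl hxn, Finset.image_insert]
    simp [antipode_injective.eq_iff]

/-- A label set is alternating from `t` if, ordered by first coordinate, its signs alternate
and the first sign is `t`. -/
def IsAlternating (t : Bool) (σ : Finset (ℕ × Bool)) : Prop :=
  ∀ a ∈ σ, a.2 = (t ^^ decide (Odd (σ.filter (fun b => b.1 < a.1)).card))

open Classical in
/-- The indicator cochain of alternating label sets. -/
noncomputable def altCochain (t : Bool) (σ : Finset (ℕ × Bool)) : ZMod 2 :=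
  if IsAlternating t σ then 1 else 0

theorem altCochain_image_antipode (t : Bool) (σ : Finset (ℕ × Bool)) :
    altCochain t (σ.image antipode) = altCochain (!t) σ := by
  have h : ∀ a : ℕ, ((σ.image antipode).filter (fun b => b.1 < a)).card =
      (σ.filter (fun b => b.1 < a)).card := fun a => by
    rw [Finset.filter_image, Finset.card_image_of_injective _ antipode_injective]
    rfl
  have : IsAlternating t (σ.image antipode) ↔ IsAlternating (!t) σ := by
    unfold IsAlternating
    rw [Finset.forall_mem_image]
    refine forall₂_congr fun a _ => ?_
    rw [h (antipode a).1]
    change (!a.2) = (t ^^ decide (Odd (σ.filter (fun b => b.1 < a.1)).card)) ↔ _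
    generalize decide (Odd (σ.filter (fun b => b.1 < a.1)).card) = r
    cases a.2 <;> cases t <;> cases r <;> decide
  classical
  unfold altCochain
  exact if_congr this rfl rfl

theorem altCochain_insert (t : Bool) (σ : Finset (ℕ × Bool)) (a : ℕ × Bool)
    (h : ∀ b ∈ σ, b.1 < a.1) :
    altCochain t (insert a σ) =
      if a.2 = (t ^^ decide (Odd σ.card)) then altCochain t σ else 0 := by
  have h1 : (insert a σ).filter (fun b => b.1 < a.1) = σ := by
    rw [Finset.filter_insert, if_neg (lt_irrefl _), Finset.filter_true_of_mem h]
  have h2 : ∀ b ∈ σ, (insert a σ).filter (fun c => c.1 < b.1) = σ.filter (fun c => c.1 < b.1) :=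
    fun b hb => by rw [Finset.filter_insert, if_neg (h b hb).not_gt]
  have : IsAlternating t (insert a σ) ↔
      a.2 = (t ^^ decide (Odd σ.card)) ∧ IsAlternating t σ := by
    unfold IsAlternating
    rw [Finset.forall_mem_insert, h1]
    refine and_congr_right fun _ => forall₂_congr fun b hb => ?_
    rw [h2 b hb]
  simp only [altCochain, this]
  split_ifs <;> simp_all

theorem coboundary_altCochain (σ : Finset (ℕ × Bool))
    (hσ : Set.InjOn Prod.fst (σ : Set (ℕ × Bool))) :
    coboundary (altCochain true) σ = altCochain true σ + altCochain false σ := by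
  induction σ using Finset.induction_on_max_value (fun a : ℕ × Bool => a.1) with
  | empty => simp [coboundary, altCochain, IsAlternating, CharTwo.add_self_eq_zero]
  | insert a s ha hmax ih =>
    rw [Finset.coe_insert] at hσ
    have hlt : ∀ b ∈ s, b.1 < a.1 := fun b hb => lt_of_le_of_ne (hmax b hb) fun e =>
      ha (hσ (Set.mem_insert_of_mem _ hb) (Set.mem_insert _ _) e ▸ hb)
    have ih := ih (hσ.mono (Set.subset_insert _ _))
    have hsum : ∑ w ∈ s, altCochain true ((insert a s).erase w) =
        if a.2 = decide (Odd s.card) then coboundary (altCochain true) s else 0 := by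
      have hterm : ∀ w ∈ s, altCochain true ((insert a s).erase w) =
          if a.2 = decide (Odd s.card) then altCochain true (s.erase w) else 0 := by
        intro w hw
        have hc : Odd (s.erase w).card ↔ ¬ Odd s.card := by
          rw [← Finset.card_erase_add_one hw, Nat.odd_add_one, not_not]
        rw [Finset.erase_insert_of_ne (ne_of_mem_of_not_mem hw ha).symm,
          altCochain_insert _ _ _ fun b hb => hlt b (Finset.mem_of_mem_erase hb)]
        by_cases hO : Odd s.card <;>
          simp only [hc, hO, decide_not, decide_true, decide_false] <;> rfl
      rw [Finset.sum_congr rfl hterm]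
      split_ifs <;> simp [coboundary]
    rw [coboundary, Finset.sum_insert ha, Finset.erase_insert ha, hsum, ih,
      altCochain_insert _ _ _ hlt, altCochain_insert _ _ _ hlt]
    generalize altCochain true s = p
    generalize altCochain false s = q
    generalize decide (Odd s.card) = r
    cases a.2 <;> cases r <;> simp <;> revert p q <;> decide

/-- The full sign vector on `E` that is positive exactly on `T`. -/
def signVector (E T : Finset β) : Finset (β × Bool) := E.image fun i => (i, decide (i ∈ T))

theorem card_signVector (E T : Finset β) : (signVector E T).card = E.card :=
  Finset.card_image_of_injective _ fun _ _ h => congrArg Prod.fst h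

theorem mem_signVector {E T : Finset β} {l : β × Bool} :
    l ∈ signVector E T ↔ l.1 ∈ E ∧ l.2 = decide (l.1 ∈ T) := by
  obtain ⟨i, s⟩ := l
  simp only [signVector, Finset.mem_image, Prod.mk.injEq]
  constructor
  · rintro ⟨j, hj, rfl, rfl⟩
    exact ⟨hj, rfl⟩
  · rintro ⟨hi, hs⟩
    exact ⟨i, hi, rfl, hs.symm⟩

theorem signVector_insert_of_notMem {E T : Finset β} {d : β} (hd : d ∉ T) :
    signVector (insert d E) T = insert (d, false) (signVector E T) := by
  simp [signVector, Finset.image_insert, hd]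

theorem signVector_insert_insert {E T : Finset β} {d : β} (hd : d ∉ E) :
    signVector (insert d E) (insert d T) = insert (d, true) (signVector E T) := by
  simp only [signVector, Finset.image_insert, Finset.mem_insert_self, decide_true]
  congr 1
  refine Finset.image_congr fun i hi => ?_
  have : i ≠ d := fun e => hd (e ▸ hi)
  simp [this]

theorem signVector_sdiff (E T : Finset β) :
    signVector E (E \ T) = (signVector E T).image antipode := by
  simp only [signVector, Finset.image_image]
  refine Finset.image_congr fun i hi => ?_
  simp only [Finset.mem_coe] at hi
  simp [antipode, hi]

/-- The value of `φ` on the fundamental cycle of the sphere of sign vectors on `E`. -/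
def sphereSum (lam : Finset (β × Bool) → ℕ × Bool) (E : Finset β)
    (φ : Finset (ℕ × Bool) → ZMod 2) : ZMod 2 :=
  ∑ T ∈ E.powerset, chainSum lam E.card (signVector E T) φ

/-- The value of `φ` on the hemisphere of sign vectors on `insert d E` with sign `t` at `d`. -/
def hemisphereSum (lam : Finset (β × Bool) → ℕ × Bool) (E : Finset β) (d : β) (t : Bool)
    (φ : Finset (ℕ × Bool) → ZMod 2) : ZMod 2 :=
  ∑ T ∈ E.powerset, chainSum lam (E.card + 1) (insert (d, t) (signVector E T)) φ

theorem notMem_signVector {E T : Finset β} {d : β} (hd : d ∉ E) (t : Bool) :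
    (d, t) ∉ signVector E T := fun h => hd (mem_signVector.1 h).1

theorem sphereSum_insert (lam : Finset (β × Bool) → ℕ × Bool) {E : Finset β} {d : β}
    (hd : d ∉ E) (φ : Finset (ℕ × Bool) → ZMod 2) :
    sphereSum lam (insert d E) φ =
      hemisphereSum lam E d false φ + hemisphereSum lam E d true φ := by
  unfold sphereSum hemisphereSum
  rw [Finset.sum_powerset_insert hd, Finset.card_insert_of_notMem hd]
  congr 1 <;> refine Finset.sum_congr rfl fun T hT => ?_
  · rw [signVector_insert_of_notMem fun h => hd (Finset.mem_powerset.1 hT h)]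
  · rw [signVector_insert_insert hd]

theorem hemisphereSum_coboundary (lam : Finset (β × Bool) → ℕ × Bool) {E : Finset β} {d : β}
    (hd : d ∉ E) (t : Bool) (φ : Finset (ℕ × Bool) → ZMod 2) :
    hemisphereSum lam E d t (coboundary φ) = sphereSum lam E φ := by
  have hcard : ∀ T, (insert (d, t) (signVector E T)).card = E.card + 1 := fun T => by
    rw [Finset.card_insert_of_notMem (notMem_signVector hd t), card_signVector]
  simp only [hemisphereSum, sphereSum, chainSum_coboundary _ _ _ (hcard _)]
  simp only [Finset.sum_insert (notMem_signVector hd t), Finset.sum_add_distrib,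
    Finset.erase_insert (notMem_signVector hd t)]
  rw [add_eq_left]
  have himage : ∀ T : Finset β, ∀ f : β × Bool → ZMod 2,
      ∑ l ∈ signVector E T, f l = ∑ i ∈ E, f (i, decide (i ∈ T)) := fun T f =>
    Finset.sum_image fun _ _ _ _ h => congrArg Prod.fst h
  simp only [himage]
  rw [Finset.sum_comm]
  refine Finset.sum_eq_zero fun i hi => ?_
  have hid : i ≠ d := fun e => hd (e ▸ hi)
  refine Finset.sum_involution (fun T _ => symmDiff T {i}) ?_ ?_ ?_ ?_
  · intro T _
    have : (insert (d, t) (signVector E T)).erase (i, decide (i ∈ T)) =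
        (insert (d, t) (signVector E (symmDiff T {i}))).erase
          (i, decide (i ∈ symmDiff T {i})) := by
      ext ⟨j, s⟩
      simp only [Finset.mem_erase, Finset.mem_insert, mem_signVector, Finset.mem_symmDiff,
        Finset.mem_singleton, Prod.mk.injEq]
      by_cases hj : j = i
      · subst hj
        simp only [hid, hi]
        by_cases hT : j ∈ T <;> simp [hT]
      · simp [hj]
    rw [this]
    exact CharTwo.add_self_eq_zero _
  · intro T _ _ h
    have := symmDiff_eq_left.1 h
    simp at this
  · intro T hT
    simp only [Finset.mem_powerset] at hT ⊢
    intro j hj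
    rcases Finset.mem_symmDiff.1 hj with h | h
    · exact hT h.1
    · rwa [Finset.mem_singleton.1 h.1]
  · intro T _
    exact symmDiff_symmDiff_cancel_right _ _

theorem isSignVector_signVector (E T : Finset β) : IsSignVector E (signVector E T) := by
  rintro ⟨i, s⟩ h
  rw [mem_signVector] at h
  refine ⟨h.1, fun h' => ?_⟩
  have hneg : (!s) = decide (i ∈ T) := (mem_signVector.1 h').2
  rw [show s = _ from h.2] at hneg
  exact Bool.not_ne_self _ hneg

/-- The labelling conditions of the octahedral Tucker lemma: `lam` is antipodal and no two
comparable nonempty sign vectors have opposite labels. -/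
structure IsTuckerLabelling (E : Finset β) (lam : Finset (β × Bool) → ℕ × Bool) : Prop where
  antipodal : ∀ x, IsSignVector E x → x.Nonempty → lam (x.image antipode) = antipode (lam x)
  compatible : ∀ x y, IsSignVector E y → x ⊆ y → x.Nonempty → lam x ≠ antipode (lam y)

theorem IsTuckerLabelling.sphereSum_altCochain {E : Finset β}
    {lam : Finset (β × Bool) → ℕ × Bool} (h : IsTuckerLabelling E lam) {F : Finset β}
    (hF : F ⊆ E) : sphereSum lam F (altCochain true) = 1 := by
  induction F using Finset.induction_on with
  | empty => simp [sphereSum, chainSum, altCochain, IsAlternating]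
  | insert d F hd ih =>
    have hsv : ∀ T ∈ F.powerset, ∀ t, IsSignVector E (insert (d, t) (signVector F T)) := by
      intro T hT t
      have hdT : d ∉ T := fun h => hd (Finset.mem_powerset.1 hT h)
      have hmono : ∀ x, IsSignVector (insert d F) x → IsSignVector E x :=
        fun x hx a ha => ⟨hF (hx a ha).1, (hx a ha).2⟩
      apply hmono
      cases t
      · rw [← signVector_insert_of_notMem hdT]
        exact isSignVector_signVector _ _
      · rw [← signVector_insert_insert hd]
        exact isSignVector_signVector _ _
    have hcard : ∀ T t, (insert (d, t) (signVector F T)).card = F.card + 1 := fun T t => by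
      rw [Finset.card_insert_of_notMem (notMem_signVector hd t), card_signVector]
    have hneg : hemisphereSum lam F d false (altCochain true) =
        hemisphereSum lam F d true (altCochain false) := by
      unfold hemisphereSum
      refine Finset.sum_nbij' (fun T => F \ T) (fun T => F \ T) (by simp) (by simp)
        (fun T hT => by simpa using hT) (fun T hT => by simpa using hT) fun T hT => ?_
      have hx : insert (d, false) (signVector F T) =
          (insert (d, true) (signVector F (F \ T))).image antipode := by
        rw [Finset.image_insert, ← signVector_sdiff,
          Finset.sdiff_sdiff_eq_self (Finset.mem_powerset.1 hT)]
        rfl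
      rw [hx, chainSum_image_antipode _ _ _ (hcard _ _) fun y hy hyn =>
        h.antipodal y ((hsv _ (by simp) _).mono hy) hyn]
      congr 1
      funext σ
      exact altCochain_image_antipode _ _
    rw [sphereSum_insert lam hd, hneg, ← ih ((Finset.subset_insert _ _).trans hF),
      ← hemisphereSum_coboundary lam hd true]
    simp only [hemisphereSum, ← Finset.sum_add_distrib, ← chainSum_add]
    refine Finset.sum_congr rfl fun T hT => ?_
    refine chainSum_congr lam _ _ (hcard _ _) (fun y z hyz hz hy =>
      h.compatible y z ((hsv T hT true).mono hz) hyz hy) _ _ fun σ _ _ hσ => ?_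
    rw [coboundary_altCochain σ hσ, Pi.add_apply, add_comm]

/-- The octahedral Tucker lemma. -/
theorem IsTuckerLabelling.card_le {E : Finset β} {lam : Finset (β × Bool) → ℕ × Bool}
    (h : IsTuckerLabelling E lam) {m : ℕ}
    (hm : ∀ x, IsSignVector E x → x.Nonempty → (lam x).1 < m) : E.card ≤ m := by
  by_contra! hlt
  refine one_ne_zero (α := ZMod 2) ?_
  rw [← h.sphereSum_altCochain subset_rfl]
  refine Finset.sum_eq_zero fun T _ => ?_
  have hsv := isSignVector_signVector E T
  have hzero : ∀ (k : ℕ) (x : Finset (β × Bool)),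
      chainSum lam k x (fun _ => (0 : ZMod 2)) = 0 := by
    intro k x
    have := chainSum_add lam k x 0 0
    rwa [add_zero, left_eq_add] at this
  rw [← hzero E.card (signVector E T)]
  refine chainSum_congr lam _ _ (card_signVector E T) (fun y z hyz hz hy =>
    h.compatible y z (hsv.mono hz) hyz hy) _ _ fun σ hσ hσl hσi => ?_
  have : σ.card ≤ (Finset.range m).card := by
    refine Finset.card_le_card_of_injOn Prod.fst (fun a ha => ?_) hσi
    obtain ⟨y, hy, hyn, rfl⟩ := hσl a ha
    simpa using hm y (hsv.mono hy) hyn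
  simp at this
  omega

end Labels

section KneserColouring

variable {β : Type*} [DecidableEq β]

/-- The `k`-subsets of `N` that contain `P` and avoid `Q`. -/
def completions (N : Finset β) (k : ℕ) (P Q : Finset β) : Finset (Finset β) :=
  (N.powersetCard k).filter fun A => P ⊆ A ∧ Disjoint A Q

theorem mem_completions {N : Finset β} {k : ℕ} {P Q A : Finset β} :
    A ∈ completions N k P Q ↔ (A ⊆ N ∧ A.card = k) ∧ P ⊆ A ∧ Disjoint A Q := by
  rw [completions, Finset.mem_filter, Finset.mem_powersetCard]

theorem completions_nonempty {N : Finset β} {k : ℕ} (hN : N.card = 2 * k) {P Q : Finset β}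
    (hP : P ⊆ N) (hQ : Q ⊆ N) (hPQ : Disjoint P Q) (hp : P.card ≤ k) (hq : Q.card ≤ k) :
    (completions N k P Q).Nonempty := by
  have hc := Finset.card_sdiff_of_subset hQ
  obtain ⟨A, hPA, hA, hcard⟩ := Finset.exists_subsuperset_card_eq
    (Finset.subset_sdiff.2 ⟨hP, hPQ⟩) hp (by omega)
  exact ⟨A, mem_completions.2 ⟨⟨hA.trans Finset.sdiff_subset, hcard⟩, hPA,
    (Finset.subset_sdiff.1 hA).2⟩⟩

theorem six_le_card_completions {N : Finset β} {k : ℕ} (hN : N.card = 2 * k) {P Q : Finset β}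
    (hP : P ⊆ N) (hQ : Q ⊆ N) (hPQ : Disjoint P Q) (hp : P.card + 2 = k)
    (hq : Q.card + 2 = k) : 6 ≤ (completions N k P Q).card := by
  have hZ : (N \ (P ∪ Q)).card = 4 := by
    rw [Finset.card_sdiff_of_subset (Finset.union_subset hP hQ),
      Finset.card_union_of_disjoint hPQ]
    omega
  have hdisj : ∀ X ∈ (N \ (P ∪ Q)).powersetCard 2, Disjoint P X ∧ Disjoint Q X := by
    intro X hX
    exact Finset.disjoint_union_left.1
      (Finset.disjoint_of_subset_right (Finset.mem_powersetCard.1 hX).1 Finset.disjoint_sdiff)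
  have h6 : ((N \ (P ∪ Q)).powersetCard 2).card = 6 := by
    rw [Finset.card_powersetCard, hZ]
    rfl
  rw [← h6]
  refine Finset.card_le_card_of_injOn (fun X => P ∪ X) (fun X hX => ?_) fun X hX Y hY hXY => ?_
  · obtain ⟨h1, h2⟩ := hdisj X hX
    obtain ⟨hXs, hXc⟩ := Finset.mem_powersetCard.1 hX
    exact mem_completions.2 ⟨⟨Finset.union_subset hP (hXs.trans Finset.sdiff_subset),
      by rw [Finset.card_union_of_disjoint h1]; omega⟩, Finset.subset_union_left,
      Finset.disjoint_union_left.2 ⟨hPQ, h2.symm⟩⟩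
  · rw [← Finset.union_sdiff_cancel_left (hdisj X hX).1,
      ← Finset.union_sdiff_cancel_left (hdisj Y hY).1]
    exact congrArg (· \ P) hXY

/-- The colours occurring among the completions of `(P, Q)`; when both `P` and `Q` have `k - 2`
elements, a colour is required to occur twice. -/
def abundantColours (N : Finset β) (k : ℕ) (col : Finset β → ℕ) (P Q : Finset β) : Finset ℕ :=
  (Finset.range 4).filter fun i =>
    (if P.card + 2 = k ∧ Q.card + 2 = k then 2 else 1) ≤
      ((completions N k P Q).filter fun A => col A = i).card

/-- The largest colour abundant for `(P, Q)` or for `(Q, P)`. -/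
def topColour (N : Finset β) (k : ℕ) (col : Finset β → ℕ) (P Q : Finset β) : ℕ :=
  (abundantColours N k col P Q ∪ abundantColours N k col Q P).sup id

theorem topColour_comm (N : Finset β) (k : ℕ) (col : Finset β → ℕ) (P Q : Finset β) :
    topColour N k col P Q = topColour N k col Q P := by
  rw [topColour, topColour, Finset.union_comm]

/-- A colouring of the `k`-subsets of the `2k`-set `N` with four colours in which any two sets of
the same colour share at least two elements. -/
structure IsTwoIntersectingColouring (N : Finset β) (k : ℕ) (col : Finset β → ℕ) : Prop where
  card_eq : N.card = 2 * k
  lt_four : ∀ A, A ⊆ N → A.card = k → col A < 4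
  two_le : ∀ A B, A ⊆ N → B ⊆ N → A.card = k → B.card = k → col A = col B → 2 ≤ (A ∩ B).card

namespace IsTwoIntersectingColouring

variable {N : Finset β} {k : ℕ} {col : Finset β → ℕ}

theorem abundantColours_nonempty (h : IsTwoIntersectingColouring N k col) {P Q : Finset β}
    (hP : P ⊆ N) (hQ : Q ⊆ N) (hPQ : Disjoint P Q) (hp : P.card ≤ k) (hq : Q.card ≤ k) :
    (abundantColours N k col P Q).Nonempty := by
  have hcol : ∀ A ∈ completions N k P Q, col A ∈ Finset.range 4 := fun A hA =>
    Finset.mem_range.2 (h.lt_four A (mem_completions.1 hA).1.1 (mem_completions.1 hA).1.2)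
  by_cases hs : P.card + 2 = k ∧ Q.card + 2 = k
  · obtain ⟨i, hi, hc⟩ := Finset.exists_lt_card_fiber_of_mul_lt_card_of_maps_to (n := 1) hcol
      (by have := six_le_card_completions h.card_eq hP hQ hPQ hs.1 hs.2; simp; omega)
    exact ⟨i, Finset.mem_filter.2 ⟨hi, by rw [if_pos hs]; exact hc⟩⟩
  · obtain ⟨A, hA⟩ := completions_nonempty h.card_eq hP hQ hPQ hp hq
    refine ⟨col A, Finset.mem_filter.2 ⟨hcol A hA, ?_⟩⟩
    rw [if_neg hs]
    exact Finset.card_pos.2 ⟨A, Finset.mem_filter.2 ⟨hA, rfl⟩⟩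

theorem inter_eq_sdiff (h : IsTwoIntersectingColouring N k col) {P Q A B : Finset β}
    (hp : k ≤ P.card + 2) (hA : A ∈ completions N k P Q) (hB : B ∈ completions N k Q P)
    (hAB : col A = col B) : A ∩ B = A \ P ∧ P.card + 2 = k := by
  obtain ⟨⟨hAN, hAk⟩, hPA, -⟩ := mem_completions.1 hA
  obtain ⟨⟨hBN, hBk⟩, -, hBP⟩ := mem_completions.1 hB
  have h2 := h.two_le A B hAN hBN hAk hBk hAB
  have hsub : A ∩ B ⊆ A \ P := Finset.subset_sdiff.2
    ⟨Finset.inter_subset_left, Finset.disjoint_of_subset_left Finset.inter_subset_right hBP⟩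
  have hc := Finset.card_sdiff_of_subset hPA
  have hle := Finset.card_le_card hsub
  exact ⟨Finset.eq_of_subset_of_card_le hsub (by omega), by omega⟩

theorem notMem_abundantColours (h : IsTwoIntersectingColouring N k col) {P Q P' Q' : Finset β}
    (hp : k ≤ P.card + 2) (hq : k ≤ Q.card + 2) (hP : P ⊆ P') (hQ : Q ⊆ Q') {i : ℕ}
    (hi : i ∈ abundantColours N k col P Q) : i ∉ abundantColours N k col Q' P' := by
  intro hi'
  have hi := (Finset.mem_filter.1 hi).2
  have hi' := (Finset.mem_filter.1 hi').2
  obtain ⟨B, hmem⟩ := Finset.card_pos.1 ((show 0 < _ by split_ifs <;> omega).trans_le hi')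
  obtain ⟨hB', rfl⟩ := Finset.mem_filter.1 hmem
  have hB : B ∈ completions N k Q P := by
    obtain ⟨hBN, hQB, hBP⟩ := mem_completions.1 hB'
    exact mem_completions.2 ⟨hBN, hQ.trans hQB, Finset.disjoint_of_subset_right hP hBP⟩
  have key : ∀ A ∈ completions N k P Q, col A = col B →
      A = P ∪ (B \ Q) ∧ P.card + 2 = k ∧ Q.card + 2 = k := by
    intro A hA hAB
    obtain ⟨e1, h1⟩ := h.inter_eq_sdiff hp hA hB hAB
    obtain ⟨e2, h2⟩ := h.inter_eq_sdiff hq hB hA hAB.symm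
    refine ⟨?_, h1, h2⟩
    rw [← e2, Finset.inter_comm, e1, Finset.union_sdiff_of_subset (mem_completions.1 hA).2.1]
  obtain ⟨A, hA⟩ := Finset.card_pos.1 ((show 0 < _ by split_ifs <;> omega).trans_le hi)
  obtain ⟨hA, hAB⟩ := Finset.mem_filter.1 hA
  rw [if_pos (key A hA hAB).2] at hi
  refine absurd hi (not_le.2 (Nat.lt_succ_of_le (Finset.card_le_one.2 ?_)))
  intro A₁ h₁ A₂ h₂
  rw [Finset.mem_filter] at h₁ h₂
  rw [(key A₁ h₁.1 h₁.2).1, (key A₂ h₂.1 h₂.2).1]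

theorem topColour_mem (h : IsTwoIntersectingColouring N k col) {P Q : Finset β}
    (hP : P ⊆ N) (hQ : Q ⊆ N) (hPQ : Disjoint P Q) (hp : P.card ≤ k) (hq : Q.card ≤ k) :
    topColour N k col P Q ∈ abundantColours N k col P Q ∨
      topColour N k col P Q ∈ abundantColours N k col Q P := by
  rw [← Finset.mem_union]
  obtain ⟨i, hi, he⟩ := Finset.exists_mem_eq_sup
    (abundantColours N k col P Q ∪ abundantColours N k col Q P)
    ((h.abundantColours_nonempty hP hQ hPQ hp hq).mono Finset.subset_union_left) id
  rw [topColour, he]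
  exact hi

theorem topColour_lt (h : IsTwoIntersectingColouring N k col) {P Q : Finset β}
    (hP : P ⊆ N) (hQ : Q ⊆ N) (hPQ : Disjoint P Q) (hp : P.card ≤ k) (hq : Q.card ≤ k) :
    topColour N k col P Q < 4 := by
  rcases h.topColour_mem hP hQ hPQ hp hq with hm | hm <;>
    exact Finset.mem_range.1 (Finset.mem_filter.1 hm).1

theorem topColour_pos (h : IsTwoIntersectingColouring N k col) {P Q : Finset β}
    (hP : P ⊆ N) (hQ : Q ⊆ N) (hPQ : Disjoint P Q) (hp : P.card ≤ k) (hq : Q.card ≤ k)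
    (hp' : k ≤ P.card + 2) (hq' : k ≤ Q.card + 2) : 0 < topColour N k col P Q := by
  obtain ⟨i, hi⟩ := h.abundantColours_nonempty hP hQ hPQ hp hq
  obtain ⟨j, hj⟩ := h.abundantColours_nonempty hQ hP hPQ.symm hq hp
  have hij : i ≠ j := fun e =>
    h.notMem_abundantColours hp' hq' subset_rfl subset_rfl hi (e ▸ hj)
  have h1 : i ≤ topColour N k col P Q := Finset.le_sup (f := id) (Finset.mem_union_left _ hi)
  have h2 : j ≤ topColour N k col P Q := Finset.le_sup (f := id) (Finset.mem_union_right _ hj)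
  omega

end IsTwoIntersectingColouring

/-- The unsigned label of the sign vector with positive part `P` and negative part `Q`. -/
def labelIndex (N : Finset β) (k : ℕ) (col : Finset β → ℕ) (P Q : Finset β) : ℕ :=
  if min P.card Q.card + 2 < k then
    if P.card = Q.card then 2 * P.card - 1 else 2 * min P.card Q.card
  else if k < max P.card Q.card then 2 * k - 5
  else 2 * k - 5 + topColour N k col P Q

open Classical in
/-- The sign of the label of the sign vector with positive part `P` and negative part `Q`. -/
noncomputable def labelSign (N : Finset β) (k : ℕ) (col : Finset β → ℕ) (P Q : Finset β) :
    Bool :=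
  if P.card = Q.card ∧ P.card + 2 < k then decide (WellOrderingRel P Q)
  else if min P.card Q.card + 2 < k ∨ k < max P.card Q.card then decide (Q.card < P.card)
  else decide (topColour N k col P Q ∈ abundantColours N k col P Q)

theorem labelIndex_comm (N : Finset β) (k : ℕ) (col : Finset β → ℕ) (P Q : Finset β) :
    labelIndex N k col P Q = labelIndex N k col Q P := by
  simp only [labelIndex, topColour_comm N k col P Q, min_comm P.card, max_comm P.card]
  grind

namespace IsTwoIntersectingColouring

variable {N : Finset β} {k : ℕ} {col : Finset β → ℕ}

theorem labelIndex_lt (h : IsTwoIntersectingColouring N k col) (hk : 3 ≤ k) {P Q : Finset β}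
    (hP : P ⊆ N) (hQ : Q ⊆ N) (hPQ : Disjoint P Q) : labelIndex N k col P Q < 2 * k - 1 := by
  have := h.topColour_lt hP hQ hPQ
  unfold labelIndex
  split_ifs <;> omega

theorem labelSign_swap (h : IsTwoIntersectingColouring N k col) {P Q : Finset β}
    (hP : P ⊆ N) (hQ : Q ⊆ N) (hPQ : Disjoint P Q) (hne : P ≠ Q) :
    labelSign N k col Q P = !labelSign N k col P Q := by
  classical
  have hcard := Finset.card_le_card (Finset.union_subset hP hQ)
  rw [Finset.card_union_of_disjoint hPQ, h.card_eq] at hcard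
  unfold labelSign
  rw [topColour_comm N k col Q P, min_comm Q.card, max_comm Q.card]
  by_cases h1 : P.card = Q.card ∧ P.card + 2 < k
  · rw [if_pos h1, if_pos ⟨h1.1.symm, h1.1 ▸ h1.2⟩, ← decide_not, decide_eq_decide]
    refine ⟨fun h2 h3 => asymm_of WellOrderingRel h2 h3, fun h2 => ?_⟩
    rcases trichotomous_of WellOrderingRel P Q with h3 | h3 | h3
    · exact absurd h3 h2
    · exact absurd h3 hne
    · exact h3
  · rw [if_neg h1, if_neg (by omega)]
    split_ifs with h2
    · rw [← decide_not, decide_eq_decide]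
      omega
    · rw [← decide_not, decide_eq_decide]
      have hm := h.topColour_mem hP hQ hPQ (by omega) (by omega)
      have hd := h.notMem_abundantColours (P := P) (Q := Q) (i := topColour N k col P Q)
        (by omega) (by omega) subset_rfl subset_rfl
      tauto

theorem labelSign_eq (h : IsTwoIntersectingColouring N k col) (hk : 3 ≤ k)
    {P Q P' Q' : Finset β} (hP : P ⊆ P') (hQ : Q ⊆ Q') (hP' : P' ⊆ N) (hQ' : Q' ⊆ N)
    (hPQ : Disjoint P' Q') (hne : 0 < P.card + Q.card)
    (hl : labelIndex N k col P Q = labelIndex N k col P' Q') :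
    labelSign N k col P Q = labelSign N k col P' Q' := by
  have hcard := Finset.card_le_card (Finset.union_subset hP' hQ')
  rw [Finset.card_union_of_disjoint hPQ, h.card_eq] at hcard
  have hp := Finset.card_le_card hP
  have hq := Finset.card_le_card hQ
  have hPN := hP.trans hP'
  have hQN := hQ.trans hQ'
  have hPQ₀ : Disjoint P Q := Finset.disjoint_of_subset_left hP
    (Finset.disjoint_of_subset_right hQ hPQ)
  have hpos := h.topColour_pos hPN hQN hPQ₀
  have hpos' := h.topColour_pos hP' hQ' hPQ
  by_cases heq : P.card = P'.card ∧ Q.card = Q'.card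
  · rw [Finset.eq_of_subset_of_card_le hP heq.1.ge, Finset.eq_of_subset_of_card_le hQ heq.2.ge]
  unfold labelIndex at hl
  unfold labelSign
  by_cases hs : min P.card Q.card + 2 < k ∨ k < max P.card Q.card
  · have h1 : ¬(P.card = Q.card ∧ P.card + 2 < k) := by
      split_ifs at hl <;> omega
    have h2 : ¬(P'.card = Q'.card ∧ P'.card + 2 < k) := by
      split_ifs at hl <;> omega
    have h3 : min P'.card Q'.card + 2 < k ∨ k < max P'.card Q'.card := by
      split_ifs at hl <;> omega
    rw [if_neg h1, if_neg h2, if_pos hs, if_pos h3, decide_eq_decide]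
    split_ifs at hl <;> omega
  · have h1 : ¬(P.card = Q.card ∧ P.card + 2 < k) := by omega
    have h3 : ¬(min P'.card Q'.card + 2 < k ∨ k < max P'.card Q'.card) := by
      split_ifs at hl <;> omega
    have h2 : ¬(P'.card = Q'.card ∧ P'.card + 2 < k) := by omega
    rw [if_neg h1, if_neg h2, if_neg hs, if_neg h3, decide_eq_decide]
    have htop : topColour N k col P Q = topColour N k col P' Q' := by
      split_ifs at hl <;> omega
    have hm := h.topColour_mem hPN hQN hPQ₀ (by omega) (by omega)
    have hm' := h.topColour_mem hP' hQ' hPQ (by omega) (by omega)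
    have hd := h.notMem_abundantColours (i := topColour N k col P' Q')
      (by omega : k ≤ P.card + 2) (by omega : k ≤ Q.card + 2) hP hQ
    have hd' := h.notMem_abundantColours (i := topColour N k col P' Q')
      (by omega : k ≤ Q.card + 2) (by omega : k ≤ P.card + 2) hQ hP
    rw [htop] at hm ⊢
    exact ⟨fun hi => hm'.resolve_right (hd hi), fun hi => hm.resolve_right fun hj => hd' hj hi⟩

end IsTwoIntersectingColouring

/-- The set of elements occurring with sign `t`. -/
def signPart (t : Bool) (x : Finset (β × Bool)) : Finset β :=
  (x.filter fun a => a.2 = t).image Prod.fst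

theorem mem_signPart {t : Bool} {x : Finset (β × Bool)} {i : β} :
    i ∈ signPart t x ↔ (i, t) ∈ x := by
  simp [signPart]

theorem signPart_mono (t : Bool) {x y : Finset (β × Bool)} (h : x ⊆ y) :
    signPart t x ⊆ signPart t y := fun _ hi => mem_signPart.2 (h (mem_signPart.1 hi))

theorem signPart_image_antipode (t : Bool) (x : Finset (β × Bool)) :
    signPart t (x.image antipode) = signPart (!t) x := by
  ext i
  simp only [mem_signPart, Finset.mem_image]
  constructor
  · rintro ⟨a, ha, he⟩
    rw [← antipode_antipode a, he] at ha
    exact ha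
  · exact fun hi => ⟨_, hi, by simp [antipode]⟩

theorem IsSignVector.signPart_subset {E : Finset β} {x : Finset (β × Bool)}
    (hx : IsSignVector E x) (t : Bool) : signPart t x ⊆ E :=
  fun _ hi => (hx _ (mem_signPart.1 hi)).1

theorem IsSignVector.disjoint_signPart {E : Finset β} {x : Finset (β × Bool)}
    (hx : IsSignVector E x) : Disjoint (signPart true x) (signPart false x) :=
  Finset.disjoint_left.2 fun _ hi hi' => (hx _ (mem_signPart.1 hi)).2 (mem_signPart.1 hi')

theorem card_signPart_pos {x : Finset (β × Bool)} (hx : x.Nonempty) :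
    0 < (signPart true x).card + (signPart false x).card := by
  obtain ⟨⟨i, t⟩, h⟩ := hx
  have := Finset.card_pos.2 ⟨i, mem_signPart.2 h⟩
  cases t <;> omega

/-- The `k`-subsets of a `2k`-set cannot be coloured with four colours so that any two sets of the
same colour share at least two elements. -/
theorem not_isTwoIntersectingColouring {N : Finset β} {k : ℕ} (hk : 3 ≤ k)
    (col : Finset β → ℕ) : ¬IsTwoIntersectingColouring N k col := by
  intro h
  let lam : Finset (β × Bool) → ℕ × Bool := fun x =>
    (labelIndex N k col (signPart true x) (signPart false x),
      labelSign N k col (signPart true x) (signPart false x))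
  have hlam : IsTuckerLabelling N lam := by
    constructor
    · intro x hx hxn
      have hpos := card_signPart_pos hxn
      have hne : signPart true x ≠ signPart false x := fun e => by
        have hd := hx.disjoint_signPart
        rw [e, Finset.disjoint_self_iff_empty] at hd
        rw [e, hd] at hpos
        simp at hpos
      simp only [lam, antipode, signPart_image_antipode, Bool.not_true, Bool.not_false]
      rw [labelIndex_comm, h.labelSign_swap (hx.signPart_subset _) (hx.signPart_subset _)
        hx.disjoint_signPart hne]
    · intro x y hy hxy hxn he
      have h1 := congrArg Prod.fst he
      have h2 := congrArg Prod.snd he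
      have h3 := h.labelSign_eq hk (signPart_mono true hxy) (signPart_mono false hxy)
        (hy.signPart_subset _) (hy.signPart_subset _) hy.disjoint_signPart
        (card_signPart_pos hxn) h1
      simp only [lam, antipode, h3] at h2
      exact Bool.not_ne_self _ h2.symm
  have := hlam.card_le (m := 2 * k - 1) fun x hx _ =>
    h.labelIndex_lt hk (hx.signPart_subset _) (hx.signPart_subset _) hx.disjoint_signPart
  have := h.card_eq
  omega

end KneserColouring

section FairDivision

variable {α : Type*} [DecidableEq α]

/-- The owner of `M \ X` envies the owner of `X` even after removal of any one item of `X`. -/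
def EnviesUpToOne (M : Finset α) (v : Finset α → ℝ) (X : Finset α) : Prop :=
  ∀ D ⊆ X, D.card ≤ 1 → v (M \ X) < v (X \ D)

theorem EnviesUpToOne.two_le_card_inter {M : Finset α} {v : Finset α → ℝ}
    (hv : ∀ S T : Finset α, S ⊆ T → v S ≤ v T) {X Y : Finset α} (hXM : X ⊆ M) (hYM : Y ⊆ M)
    (hX : EnviesUpToOne M v X) (hY : EnviesUpToOne M v Y) : 2 ≤ (X ∩ Y).card := by
  by_contra! hlt
  have h1 := hX _ Finset.inter_subset_left (Nat.le_of_lt_succ hlt)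
  have h2 := hY _ Finset.inter_subset_right (Nat.le_of_lt_succ hlt)
  have h3 := hv (X \ (X ∩ Y)) (M \ Y) fun a ha => by
    have := @hXM a
    simp only [Finset.mem_sdiff, Finset.mem_inter] at ha ⊢
    tauto
  have h4 := hv (Y \ (X ∩ Y)) (M \ X) fun a ha => by
    have := @hYM a
    simp only [Finset.mem_sdiff, Finset.mem_inter] at ha ⊢
    tauto
  linarith

theorem exists_envyFree_up_to_one_of_not {M : Finset α} {v : Finset α → ℝ} {X Y : Finset α}
    (hY : M \ X = Y) (h : ¬EnviesUpToOne M v X) : ∃ D ⊆ X, D.card ≤ 1 ∧ v Y ≥ v (X \ D) := by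
  unfold EnviesUpToOne at h
  push Not at h
  rwa [hY] at h

end FairDivision

/-- For monotone valuations `v1, v2, u1, u2` (normalized at `∅`),
there exists a partition `(A1, A2)` of `M` that is doubly EF-1. -/
theorem doubly_ef1_exists_monotone {α : Type*} [DecidableEq α] (M : Finset α)
    (v1 v2 u1 u2 : Finset α → ℝ)
    (hv1 : ∀ S T : Finset α, S ⊆ T → v1 S ≤ v1 T) (hv1z : v1 ∅ = 0)
    (hv2 : ∀ S T : Finset α, S ⊆ T → v2 S ≤ v2 T) (hv2z : v2 ∅ = 0)
    (hu1 : ∀ S T : Finset α, S ⊆ T → u1 S ≤ u1 T) (hu1z : u1 ∅ = 0)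
    (hu2 : ∀ S T : Finset α, S ⊆ T → u2 S ≤ u2 T) (hu2z : u2 ∅ = 0) :
    ∃ A1 A2 : Finset α, A1 ∪ A2 = M ∧ Disjoint A1 A2 ∧
      (∃ B1 ⊆ A2, B1.card ≤ 1 ∧ v1 A1 ≥ v1 (A2 \ B1)) ∧
      (∃ B2 ⊆ A1, B2.card ≤ 1 ∧ v2 A2 ≥ v2 (A1 \ B2)) ∧
      (∃ B3 ⊆ A2, B3.card ≤ 1 ∧ u1 A1 ≥ u1 (A2 \ B3)) ∧
      (∃ B4 ⊆ A1, B4.card ≤ 1 ∧ u2 A2 ≥ u2 (A1 \ B4)) := by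
  classical
  by_contra! hno
  have hcover : ∀ L ⊆ M, EnviesUpToOne M v2 L ∨ EnviesUpToOne M u2 L ∨
      EnviesUpToOne M v1 (M \ L) ∨ EnviesUpToOne M u1 (M \ L) := by
    intro L hL
    by_contra! hn
    have hc := Finset.sdiff_sdiff_eq_self hL
    obtain ⟨D₁, hD₁, hc₁, hv₁⟩ := exists_envyFree_up_to_one_of_not hc hn.2.2.1
    obtain ⟨D₂, hD₂, hc₂, hv₂⟩ := exists_envyFree_up_to_one_of_not rfl hn.1
    obtain ⟨D₃, hD₃, hc₃, hv₃⟩ := exists_envyFree_up_to_one_of_not hc hn.2.2.2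
    obtain ⟨D₄, hD₄, hc₄, hv₄⟩ := exists_envyFree_up_to_one_of_not rfl hn.2.1
    exact absurd hv₄ (not_le.2 (hno L (M \ L) (Finset.union_sdiff_of_subset hL)
      Finset.disjoint_sdiff ⟨D₁, hD₁, hc₁, hv₁⟩ ⟨D₂, hD₂, hc₂, hv₂⟩ ⟨D₃, hD₃, hc₃, hv₃⟩
      D₄ hD₄ hc₄))
  -- Dummy items make the number of items even and let every bundle be completed to half of them.
  let N : Finset (α ⊕ ℕ) := M.disjSum (Finset.range (M.card + 6))
  let col : Finset (α ⊕ ℕ) → ℕ := fun A =>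
    if EnviesUpToOne M v2 A.toLeft then 0 else if EnviesUpToOne M u2 A.toLeft then 1
    else if EnviesUpToOne M v1 (M \ A.toLeft) then 2 else 3
  have hN : N.card = 2 * (M.card + 3) := by
    simp only [N, Finset.card_disjSum, Finset.card_range]
    omega
  have hleft : ∀ A ⊆ N, A.toLeft ⊆ M := fun A hA a ha =>
    Finset.inl_mem_disjSum.1 (hA (Finset.mem_toLeft.1 ha))
  refine not_isTwoIntersectingColouring (N := N) (k := M.card + 3) (by omega) col
    ⟨hN, fun A _ _ => by simp only [col]; split_ifs <;> omega, ?_⟩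
  intro A B hA hB hAk hBk hAB
  have hinter : (A.toLeft ∩ B.toLeft).card ≤ (A ∩ B).card := by
    rw [← Finset.toLeft_inter]
    exact Finset.card_toLeft_le
  have hcompl : ((M \ A.toLeft) ∩ (M \ B.toLeft)).card ≤ (A ∩ B).card := by
    have h1 : (M \ A.toLeft) ∩ (M \ B.toLeft) = (N \ (A ∪ B)).toLeft := by
      ext a
      simp [N]
      tauto
    have h2 := Finset.card_sdiff_of_subset (Finset.union_subset hA hB)
    have h3 := Finset.card_union_add_card_inter A B
    rw [h1]
    refine Finset.card_toLeft_le.trans ?_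
    omega
  have hfour : (EnviesUpToOne M v2 A.toLeft ∧ EnviesUpToOne M v2 B.toLeft) ∨
      (EnviesUpToOne M u2 A.toLeft ∧ EnviesUpToOne M u2 B.toLeft) ∨
      (EnviesUpToOne M v1 (M \ A.toLeft) ∧ EnviesUpToOne M v1 (M \ B.toLeft)) ∨
      (EnviesUpToOne M u1 (M \ A.toLeft) ∧ EnviesUpToOne M u1 (M \ B.toLeft)) := by
    have hcA := hcover _ (hleft A hA)
    have hcB := hcover _ (hleft B hB)
    simp only [col] at hAB
    split_ifs at hAB <;> first | omega | tauto
  rcases hfour with ⟨h1, h2⟩ | ⟨h1, h2⟩ | ⟨h1, h2⟩ | ⟨h1, h2⟩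
  · exact (h1.two_le_card_inter hv2 (hleft A hA) (hleft B hB) h2).trans hinter
  · exact (h1.two_le_card_inter hu2 (hleft A hA) (hleft B hB) h2).trans hinter
  · exact (h1.two_le_card_inter hv1 Finset.sdiff_subset Finset.sdiff_subset h2).trans hcompl
  · exact (h1.two_le_card_inter hu1 Finset.sdiff_subset Finset.sdiff_subset h2).trans hcompl
end

section
/- Let M be a finite set with |M| = m, let w : 2^M → ℝ be a monotone valuation, and let (A1, A2) and (A1', A2') be two partitions of M into two bundles. (i) If |A1 ∪ A1'| ≥ m − 1, then at least one of the two partitions (X1, X2) ∈ {(A1, A2), (A1', A2')} satisfies: there exists B ⊆ X2 with |B| ≤ 1 and w(X1) ≥ w(X2 \ B). (ii) If |A1 ∩ A1'| ≤ 1, then at least one of the two partitions (X1, X2) ∈ {(A1, A2), (A1', A2')} satisfies: there exists B ⊆ X1 with |B| ≤ 1 and w(X2) ≥ w(X1 \ B). -/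
/-- If two coverings of the same set by two bundles have second bundles sharing at most one good,
then one of them is EF-1 from the holder of the first bundle. -/
theorem exists_ef1_of_card_inter_le_one {α : Type*} [DecidableEq α]
    (w : Finset α → ℝ) (hmono : ∀ S T : Finset α, S ⊆ T → w S ≤ w T)
    {X₁ X₂ Y₁ Y₂ : Finset α} (hXY : X₁ ∪ X₂ = Y₁ ∪ Y₂) (hcard : (X₂ ∩ Y₂).card ≤ 1) :
    (∃ B ⊆ X₂, B.card ≤ 1 ∧ w X₁ ≥ w (X₂ \ B)) ∨
      (∃ B ⊆ Y₂, B.card ≤ 1 ∧ w Y₁ ≥ w (Y₂ \ B)) := by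
  have hmem := Finset.ext_iff.1 hXY
  simp only [Finset.mem_union] at hmem
  have hX : X₂ \ (X₂ ∩ Y₂) ⊆ Y₁ := by grind
  have hY : Y₂ \ (X₂ ∩ Y₂) ⊆ X₁ := by grind
  rcases le_total (w Y₁) (w X₁) with h | h
  · exact Or.inl ⟨X₂ ∩ Y₂, Finset.inter_subset_left, hcard, (hmono _ _ hX).trans h⟩
  · exact Or.inr ⟨X₂ ∩ Y₂, Finset.inter_subset_right, hcard, (hmono _ _ hY).trans h⟩

/-- For a monotone valuation `w` and two partitions `(A1, A2)`, `(A1', A2')`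
of `M` (with `|M| = m`): (i) if `|A1 ∪ A1'| ≥ m − 1`, at least one of the two partitions
is EF-1 w.r.t. `w` from the holder of the first bundle; (ii) if `|A1 ∩ A1'| ≤ 1`, at
least one of them is EF-1 w.r.t. `w` from the holder of the second bundle. -/
theorem ef1_intersection {α : Type*} [DecidableEq α] (M : Finset α) (m : ℕ)
    (hm : M.card = m)
    (w : Finset α → ℝ) (hmono : ∀ S T : Finset α, S ⊆ T → w S ≤ w T)
    (A1 A2 A1' A2' : Finset α)
    (hP1 : A1 ∪ A2 = M) (hD1 : Disjoint A1 A2)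
    (hP2 : A1' ∪ A2' = M) (hD2 : Disjoint A1' A2') :
    (m - 1 ≤ (A1 ∪ A1').card →
      (∃ B ⊆ A2, B.card ≤ 1 ∧ w A1 ≥ w (A2 \ B)) ∨
      (∃ B ⊆ A2', B.card ≤ 1 ∧ w A1' ≥ w (A2' \ B))) ∧
    ((A1 ∩ A1').card ≤ 1 →
      (∃ B ⊆ A1, B.card ≤ 1 ∧ w A2 ≥ w (A1 \ B)) ∨
      (∃ B ⊆ A1', B.card ≤ 1 ∧ w A2' ≥ w (A1' \ B))) := by
  refine ⟨fun h => exists_ef1_of_card_inter_le_one w hmono (hP1.trans hP2.symm) ?_,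
    exists_ef1_of_card_inter_le_one w hmono
      (by rw [Finset.union_comm, hP1, Finset.union_comm, hP2])⟩
  have hdisj : Disjoint (A1 ∪ A1') (A2 ∩ A2') :=
    Finset.disjoint_union_left.2
      ⟨hD1.mono_right Finset.inter_subset_left, hD2.mono_right Finset.inter_subset_right⟩
  have hsub : (A1 ∪ A1') ∪ (A2 ∩ A2') ⊆ M := by grind
  have hle := Finset.card_le_card hsub
  rw [Finset.card_union_of_disjoint hdisj] at hle
  omega
end

section
/- Let A be an m × p matrix over ℝ (or ℤ) all of whose entries lie in {0, 1, −1}, and suppose the row index set is partitioned into two sets R1 and R2 such that: all entries in rows of R1 lie in {0, 1} or all lie in {0, −1}; all entries in rows of R2 lie in {0, 1} or all lie in {0, −1}; and every column of A has at most one nonzero entry among the rows of R1 and at most one nonzero entry among the rows of R2. Then A is totally unimodular: for every k and all injective maps ρ : [k] → rows and σ : [k] → columns, the determinant of the k × k submatrix A[ρ, σ] equals 0, 1, or −1. -/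
/-- A square matrix whose rows are two-coloured, with all nonzero entries of a given colour equal
to a common sign, and with at most one nonzero entry of each colour in every column, has
determinant `0`, `1` or `-1`. -/
theorem Matrix.det_mem_of_two_colored_rows {R : Type*} [CommRing R] [IsDomain R] (s : Bool → R)
    (hs : ∀ c, s c = 1 ∨ s c = -1) {k : ℕ} (M : Matrix (Fin k) (Fin k) R) (b : Fin k → Bool)
    (hM : ∀ i j, M i j = 0 ∨ M i j = s (b i))
    (hcol : ∀ j i₁ i₂, b i₁ = b i₂ → M i₁ j ≠ 0 → M i₂ j ≠ 0 → i₁ = i₂) :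
    M.det = 0 ∨ M.det = 1 ∨ M.det = -1 := by
  induction k with
  | zero => simp
  | succ k ih =>
    by_cases h : ∃ j i, ∀ i', i' ≠ i → M i' j = 0
    · obtain ⟨j, i, hij⟩ := h
      have hdet : M.det = (-1) ^ (i + j : ℕ) * M i j *
          (M.submatrix i.succAbove j.succAbove).det := by
        rw [Matrix.det_succ_column M j]
        exact Finset.sum_eq_single i (fun i' _ hi' => by simp [hij i' hi']) (by simp)
      have hsub := ih (M.submatrix i.succAbove j.succAbove) (b ∘ i.succAbove)
        (fun _ _ => hM _ _)
        (fun _ _ _ hb h₁ h₂ => Fin.succAbove_right_injective (hcol _ _ _ hb h₁ h₂))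
      rw [hdet]
      rcases neg_one_pow_eq_or R (i + j : ℕ) with h₁ | h₁ <;>
      rcases hM i j with h₂ | h₂ <;>
      rcases hs (b i) with h₃ | h₃ <;>
      rcases hsub with h₄ | h₄ | h₄ <;>
      simp [h₁, h₂, h₃, h₄]
    · push Not at h
      left
      refine Matrix.exists_vecMul_eq_zero_iff.mp
        ⟨fun i => s (b i) * if b i then 1 else -1, fun hv => ?_, ?_⟩
      · have h₀ := congrFun hv 0
        rcases hs (b 0) with h₁ | h₁ <;> cases hb : b 0 <;> simp [hb] at h₀ h₁ <;> simp [h₁] at h₀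
      · ext j
        obtain ⟨i₁, -, h₁⟩ := h j 0
        obtain ⟨i₂, hne, h₂⟩ := h j i₁
        have hb : b i₁ ≠ b i₂ := fun hb => hne (hcol j i₁ i₂ hb h₁ h₂).symm
        have hzero : ∀ i, i ≠ i₁ ∧ i ≠ i₂ → M i j = 0 := by
          rintro i ⟨hi₁, hi₂⟩
          by_contra hi
          have hbool : ∀ x y z : Bool, y ≠ z → x = y ∨ x = z := by decide
          rcases hbool (b i) _ _ hb with hc | hc
          · exact hi₁ (hcol j _ _ hc hi h₁)
          · exact hi₂ (hcol j _ _ hc hi h₂)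
        have hsq : ∀ c, s c * s c = 1 := fun c => by rcases hs c with hc | hc <;> simp [hc]
        rw [Matrix.vecMul, dotProduct, Fintype.sum_eq_add i₁ i₂ hne.symm
          (fun i hi => by simp [hzero i hi]), (hM i₁ j).resolve_left h₁,
          (hM i₂ j).resolve_left h₂, mul_right_comm, hsq, mul_right_comm, hsq]
        cases hb₁ : b i₁ <;> cases hb₂ : b i₂ <;> simp [hb₁, hb₂] at hb ⊢


/-- A `{0, 1, −1}`-matrix whose rows split into two blocks, each block
consisting entirely of `{0, 1}`-rows or entirely of `{0, −1}`-rows, with every column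
having at most one nonzero entry within each block, is totally unimodular. -/
theorem totallyUnimodular_of_two_blocks {m p : ℕ} (A : Matrix (Fin m) (Fin p) ℝ)
    (hentries : ∀ i j, A i j = 0 ∨ A i j = 1 ∨ A i j = -1)
    (R1 R2 : Finset (Fin m))
    (hpart : R1 ∪ R2 = Finset.univ) (hdisj : Disjoint R1 R2)
    (hR1 : (∀ i ∈ R1, ∀ j, A i j = 0 ∨ A i j = 1) ∨
      (∀ i ∈ R1, ∀ j, A i j = 0 ∨ A i j = -1))
    (hR2 : (∀ i ∈ R2, ∀ j, A i j = 0 ∨ A i j = 1) ∨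
      (∀ i ∈ R2, ∀ j, A i j = 0 ∨ A i j = -1))
    (hcol1 : ∀ j, ∀ i1 ∈ R1, ∀ i2 ∈ R1, A i1 j ≠ 0 → A i2 j ≠ 0 → i1 = i2)
    (hcol2 : ∀ j, ∀ i1 ∈ R2, ∀ i2 ∈ R2, A i1 j ≠ 0 → A i2 j ≠ 0 → i1 = i2) :
    ∀ (k : ℕ) (ρ : Fin k → Fin m) (σ : Fin k → Fin p),
      Function.Injective ρ → Function.Injective σ →
      (A.submatrix ρ σ).det = 0 ∨ (A.submatrix ρ σ).det = 1 ∨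
        (A.submatrix ρ σ).det = -1 := by
  intro k ρ σ hρ _
  have sign : ∀ S : Finset (Fin m), ((∀ i ∈ S, ∀ j, A i j = 0 ∨ A i j = 1) ∨
      (∀ i ∈ S, ∀ j, A i j = 0 ∨ A i j = -1)) →
      ∃ t : ℝ, (t = 1 ∨ t = -1) ∧ ∀ i ∈ S, ∀ j, A i j = 0 ∨ A i j = t := by
    rintro S (h | h)
    · exact ⟨1, Or.inl rfl, h⟩
    · exact ⟨-1, Or.inr rfl, h⟩
  obtain ⟨s₁, hs₁, hA₁⟩ := sign R1 hR1
  obtain ⟨s₂, hs₂, hA₂⟩ := sign R2 hR2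
  have mem₂ : ∀ i, i ∉ R1 → i ∈ R2 := fun i hi =>
    (Finset.mem_union.mp (hpart ▸ Finset.mem_univ i)).resolve_left hi
  refine Matrix.det_mem_of_two_colored_rows (fun c => if c then s₁ else s₂) ?_ _
    (fun i => decide (ρ i ∈ R1)) ?_ ?_
  · rintro (_ | _) <;> simpa
  · intro i j
    by_cases hi : ρ i ∈ R1
    · simpa [hi] using hA₁ _ hi (σ j)
    · simpa [hi] using hA₂ _ (mem₂ _ hi) (σ j)
  · intro j i₁ i₂ hb h₁ h₂
    have hb' : ρ i₁ ∈ R1 ↔ ρ i₂ ∈ R1 := by simpa using hb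
    apply hρ
    by_cases hi : ρ i₁ ∈ R1
    · exact hcol1 _ _ hi _ (hb'.mp hi) h₁ h₂
    · exact hcol2 _ _ (mem₂ _ hi) _ (mem₂ _ (mt hb'.mpr hi)) h₁ h₂
end
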